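/- arXiv:2102.05704 — 2 statements merged into one kernel-verified Lean document; each statement's English description precedes it below -/
import Mathlib

section
/- (Upper bound for the relative potential under quadratic growth of f''; the pointwise core of Lemma 3.1, upper bound.) Let f : ℝ → ℝ be twice continuously differentiable and suppose there are constants A, B ≥ 0 with f''(s) ≤ A + B s² for all s ∈ ℝ. Then for all x, y ∈ ℝ, the Bregman distance satisfies f(x|y) := f(x) − f(y) − f'(y)(x − y) ≤ (A + B(x² + y²)) (x − y)². -/
/-- A differentiable convex function on `ℝ` lies above its tangent lines. -/
theorem ConvexOn.add_mul_sub_le_of_hasDerivAt {g : ℝ → ℝ} {g' y : ℝ}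
    (hg : ConvexOn ℝ Set.univ g) (hy : HasDerivAt g g' y) (x : ℝ) :
    g y + g' * (x - y) ≤ g x := by
  rcases lt_trichotomy x y with h | rfl | h
  · have := hg.slope_le_of_hasDerivAt (Set.mem_univ x) (Set.mem_univ y) h hy
    rw [slope_def_field, div_le_iff₀ (sub_pos.2 h)] at this
    linarith
  · simp
  · have := hg.le_slope_of_hasDerivAt (Set.mem_univ y) (Set.mem_univ x) h hy
    rw [slope_def_field, le_div_iff₀ (sub_pos.2 h)] at this
    linarith

/-- Upper bound for the relative (Bregman) potential under quadratic growth of f''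
    (pointwise core of Lemma 3.1, upper bound). -/
theorem bregman_upper_bound (f : ℝ → ℝ) (A B : ℝ)
    (hf : ContDiff ℝ 2 f) (hA : 0 ≤ A) (hB : 0 ≤ B)
    (hf'' : ∀ s : ℝ, deriv (deriv f) s ≤ A + B * s ^ 2) :
    ∀ x y : ℝ, f x - f y - deriv f y * (x - y) ≤ (A + B * (x ^ 2 + y ^ 2)) * (x - y) ^ 2 := by
  intro x y
  let g : ℝ → ℝ := fun s => A / 2 * s ^ 2 + B / 12 * s ^ 4 - f s
  have hg (s : ℝ) : HasDerivAt g (A * s + B / 3 * s ^ 3 - deriv f s) s := by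
    refine ((((hasDerivAt_pow 2 s).const_mul (A / 2)).add
      ((hasDerivAt_pow 4 s).const_mul (B / 12))).sub
      (hf.differentiable (by norm_num) s).hasDerivAt).congr_deriv ?_
    norm_num
    ring
  have hg_deriv : deriv g = fun s => A * s + B / 3 * s ^ 3 - deriv f s :=
    funext fun s => (hg s).deriv
  have hg' (s : ℝ) : HasDerivAt (deriv g) (A + B * s ^ 2 - deriv (deriv f) s) s := by
    rw [hg_deriv]
    have hf' : Differentiable ℝ (deriv f) :=
      ((contDiff_succ_iff_deriv (n := 1)).1 hf).2.2.differentiable (by norm_num)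
    refine ((((hasDerivAt_id s).const_mul A).add
      ((hasDerivAt_pow 3 s).const_mul (B / 3))).sub (hf' s).hasDerivAt).congr_deriv ?_
    norm_num
    ring
  have hconv : ConvexOn ℝ Set.univ g :=
    convexOn_univ_of_deriv2_nonneg (fun s => (hg s).differentiableAt)
      (fun s => (hg' s).differentiableAt) fun s => by
        simpa [(hg' s).deriv] using hf'' s
  have htangent := hconv.add_mul_sub_le_of_hasDerivAt (hg y) x
  have hA_nonneg : 0 ≤ A * (x - y) ^ 2 := by positivity
  have hB_nonneg : 0 ≤ B * ((x - y) ^ 2 * (10 * x ^ 2 + 8 * y ^ 2 + (x - y) ^ 2)) := by positivity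
  simp only [g] at htangent
  linarith
end

section
/- (Single-interval product-of-averages estimate with explicit constant; the core estimate (eq:est) in the appendix proof of Lemma 5.4.) Let t₀ < t₁ be real numbers, set τ := t₁ − t₀, and let u, v : ℝ → ℝ be twice continuously differentiable on [t₀, t₁]. Denote by ū := (1/τ) ∫_{t₀}^{t₁} u(t) dt and v̄ := (1/τ) ∫_{t₀}^{t₁} v(t) dt the averages of u and v, and by \overline{uv} := (1/τ) ∫_{t₀}^{t₁} u(t) v(t) dt the average of the product. Then | ū v̄ − \overline{uv} | ≤ (τ²/12) ( sup|u''| · sup|v| + sup|u'| · sup|v'| + sup|u| · sup|v''| ), where all suprema are taken over [t₀, t₁]. -/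
open intervalIntegral

/-- The double integral of products of increments, in terms of the integrals of `u`, `v` and `u * v`. -/
theorem integral_integral_mul_sub_mul_sub {a b : ℝ} {u v : ℝ → ℝ}
    (hu : ContinuousOn u (Set.uIcc a b)) (hv : ContinuousOn v (Set.uIcc a b)) :
    ∫ s in a..b, ∫ t in a..b, (u s - u t) * (v s - v t)
      = 2 * ((b - a) * ∫ t in a..b, u t * v t)
        - 2 * ((∫ t in a..b, u t) * ∫ t in a..b, v t) := by
  have iu := hu.intervalIntegrable (μ := MeasureTheory.volume)
  have iv := hv.intervalIntegrable (μ := MeasureTheory.volume)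
  have iuv : IntervalIntegrable (fun t => u t * v t) MeasureTheory.volume a b :=
    (hu.mul hv).intervalIntegrable
  have inner_eq : ∀ s, ∫ t in a..b, (u s - u t) * (v s - v t)
      = (b - a) * (u s * v s) - u s * (∫ t in a..b, v t) - v s * (∫ t in a..b, u t)
        + ∫ t in a..b, u t * v t := by
    intro s
    have h : ∀ t, (u s - u t) * (v s - v t)
        = u s * v s - u s * v t - v s * u t + u t * v t := fun t => by ring
    simp_rw [h]
    rw [integral_add _ iuv, integral_sub _ (iu.const_mul _), integral_sub _ (iv.const_mul _)]
    · simp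
      ring
    · simp
    · exact intervalIntegrable_const.sub (iv.const_mul _)
    · exact (intervalIntegrable_const.sub (iv.const_mul _)).sub (iu.const_mul _)
  simp_rw [inner_eq]
  rw [integral_add _ intervalIntegrable_const, integral_sub _ (iv.mul_const _),
    integral_sub (iuv.const_mul _) (iu.mul_const _)]
  · simp
    ring
  · exact (iuv.const_mul _).sub (iu.mul_const _)
  · exact ((iuv.const_mul _).sub (iu.mul_const _)).sub (iv.mul_const _)

theorem integral_sub_left_sq (a b s : ℝ) :
    ∫ t in a..b, (s - t) ^ 2 = ((s - a) ^ 3 - (s - b) ^ 3) / 3 := by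
  rw [integral_comp_sub_left (fun x => x ^ 2), integral_pow]
  norm_num

theorem integral_integral_sub_sq (a b : ℝ) :
    ∫ s in a..b, ∫ t in a..b, (s - t) ^ 2 = (b - a) ^ 4 / 6 := by
  simp_rw [integral_sub_left_sq]
  rw [integral_div, integral_sub (Continuous.intervalIntegrable (by fun_prop) _ _)
    (Continuous.intervalIntegrable (by fun_prop) _ _),
    integral_comp_sub_right (fun x => x ^ 3), integral_comp_sub_right (fun x => x ^ 3),
    integral_pow, integral_pow]
  norm_num
  ring

/-- Chebyshev's estimate for the covariance of two Lipschitz functions on an interval. -/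
theorem abs_average_mul_average_sub_average_mul_le {a b A B : ℝ} (hab : a < b) {u v : ℝ → ℝ}
    (hu : ContinuousOn u (Set.Icc a b)) (hv : ContinuousOn v (Set.Icc a b)) (hA : 0 ≤ A)
    (hLu : ∀ s ∈ Set.Icc a b, ∀ t ∈ Set.Icc a b, |u s - u t| ≤ A * |s - t|)
    (hLv : ∀ s ∈ Set.Icc a b, ∀ t ∈ Set.Icc a b, |v s - v t| ≤ B * |s - t|) :
    |((1 / (b - a)) * ∫ t in a..b, u t) * ((1 / (b - a)) * ∫ t in a..b, v t)
        - (1 / (b - a)) * ∫ t in a..b, u t * v t| ≤ (b - a) ^ 2 / 12 * (A * B) := by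
  have hpos : 0 < b - a := sub_pos.mpr hab
  have pointwise : ∀ s ∈ Set.Icc a b, ∀ t ∈ Set.Icc a b,
      ‖(u s - u t) * (v s - v t)‖ ≤ A * B * (s - t) ^ 2 := by
    intro s hs t ht
    rw [Real.norm_eq_abs, abs_mul]
    calc _ ≤ (A * |s - t|) * (B * |s - t|) :=
          mul_le_mul (hLu s hs t ht) (hLv s hs t ht) (abs_nonneg _) (by positivity)
      _ = A * B * (s - t) ^ 2 := by rw [← sq_abs (s - t)]; ring
  have inner_le : ∀ s ∈ Set.Icc a b,
      ‖∫ t in a..b, (u s - u t) * (v s - v t)‖ ≤ A * B * ∫ t in a..b, (s - t) ^ 2 := by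
    intro s hs
    rw [← integral_const_mul]
    refine norm_integral_le_of_norm_le hab.le (.of_forall fun t ht => ?_)
      (Continuous.intervalIntegrable (by fun_prop) _ _)
    exact pointwise s hs t (Set.Ioc_subset_Icc_self ht)
  have outer_le : ‖∫ s in a..b, ∫ t in a..b, (u s - u t) * (v s - v t)‖
      ≤ A * B * ((b - a) ^ 4 / 6) := by
    rw [← integral_integral_sub_sq, ← integral_const_mul]
    refine norm_integral_le_of_norm_le hab.le (.of_forall fun s hs => ?_) ?_
    · exact inner_le s (Set.Ioc_subset_Icc_self hs)
    · simp_rw [integral_sub_left_sq]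
      exact Continuous.intervalIntegrable (by fun_prop) _ _
  rw [← Set.uIcc_of_le hab.le] at hu hv
  rw [integral_integral_mul_sub_mul_sub hu hv, Real.norm_eq_abs] at outer_le
  have factor : ((1 / (b - a)) * ∫ t in a..b, u t) * ((1 / (b - a)) * ∫ t in a..b, v t)
        - (1 / (b - a)) * ∫ t in a..b, u t * v t
      = -(2 * ((b - a) * ∫ t in a..b, u t * v t)
        - 2 * ((∫ t in a..b, u t) * ∫ t in a..b, v t)) / (2 * (b - a) ^ 2) := by
    field_simp
    ring
  rw [factor, abs_div, abs_neg, abs_of_pos (by positivity : 0 < 2 * (b - a) ^ 2),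
    div_le_iff₀ (by positivity)]
  exact outer_le.trans_eq (by ring)

/-- A differentiable function on a compact interval with continuous derivative is Lipschitz with
constant the supremum of the derivative. -/
theorem abs_sub_le_iSup_abs_deriv_mul {a b : ℝ} {f f' : ℝ → ℝ}
    (hf : ∀ t ∈ Set.Icc a b, HasDerivWithinAt f (f' t) (Set.Icc a b) t)
    (hf' : ContinuousOn f' (Set.Icc a b)) :
    ∀ s ∈ Set.Icc a b, ∀ t ∈ Set.Icc a b,
      |f s - f t| ≤ (⨆ x : Set.Icc a b, |f' x|) * |s - t| := by
  intro s hs t ht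
  have hbdd : BddAbove (Set.range fun x : Set.Icc a b => |f' x|) :=
    isCompact_range hf'.domRestrict.abs |>.bddAbove
  exact (convex_Icc a b).norm_image_sub_le_of_norm_hasDerivWithin_le hf
    (fun x hx => le_ciSup hbdd ⟨x, hx⟩) ht hs

/-- Single-interval product-of-averages estimate with explicit constant
    (the core estimate (eq:est) in the appendix proof of Lemma 5.4). -/
theorem product_of_averages (t₀ t₁ : ℝ) (ht : t₀ < t₁) (u u' u'' v v' v'' : ℝ → ℝ)
    (hu : ∀ t ∈ Set.Icc t₀ t₁, HasDerivWithinAt u (u' t) (Set.Icc t₀ t₁) t)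
    (hu' : ∀ t ∈ Set.Icc t₀ t₁, HasDerivWithinAt u' (u'' t) (Set.Icc t₀ t₁) t)
    (hu'' : ContinuousOn u'' (Set.Icc t₀ t₁))
    (hv : ∀ t ∈ Set.Icc t₀ t₁, HasDerivWithinAt v (v' t) (Set.Icc t₀ t₁) t)
    (hv' : ∀ t ∈ Set.Icc t₀ t₁, HasDerivWithinAt v' (v'' t) (Set.Icc t₀ t₁) t)
    (hv'' : ContinuousOn v'' (Set.Icc t₀ t₁)) :
    |((1 / (t₁ - t₀)) * ∫ t in t₀..t₁, u t) * ((1 / (t₁ - t₀)) * ∫ t in t₀..t₁, v t)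
        - (1 / (t₁ - t₀)) * ∫ t in t₀..t₁, u t * v t|
      ≤ (t₁ - t₀) ^ 2 / 12 *
          ((⨆ t : Set.Icc t₀ t₁, |u'' t|) * (⨆ t : Set.Icc t₀ t₁, |v t|)
            + (⨆ t : Set.Icc t₀ t₁, |u' t|) * (⨆ t : Set.Icc t₀ t₁, |v' t|)
            + (⨆ t : Set.Icc t₀ t₁, |u t|) * (⨆ t : Set.Icc t₀ t₁, |v'' t|)) := by
  have hsup : ∀ f : ℝ → ℝ, 0 ≤ ⨆ t : Set.Icc t₀ t₁, |f t| := fun f =>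
    Real.iSup_nonneg fun _ => abs_nonneg _
  refine (abs_average_mul_average_sub_average_mul_le ht
    (fun t h => (hu t h).continuousWithinAt) (fun t h => (hv t h).continuousWithinAt) (hsup u')
    (abs_sub_le_iSup_abs_deriv_mul hu fun t h => (hu' t h).continuousWithinAt)
    (abs_sub_le_iSup_abs_deriv_mul hv fun t h => (hv' t h).continuousWithinAt)).trans ?_
  gcongr
  linarith [mul_nonneg (hsup u'') (hsup v), mul_nonneg (hsup u) (hsup v'')]
end
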